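/- arXiv:1907.07025 — 8 statements merged into one kernel-verified Lean document; each statement's English description precedes it below -/
import Mathlib

section
/- A Cayley group G with generator set E is 2-acyclic if and only if for all v ∈ G and all α, β ⊆ E one has [v]_α ∩ [v]_β = [v]_{α ∩ β}. -/
open scoped Pointwise

section CayleyDefs

variable {G : Type*} [Group G]

/-- The `α`-coset of `v`, i.e. `v · ⟨α⟩` where `⟨α⟩` is the subgroup generated by `α`. -/
def coset (v : G) (α : Set G) : Set G := {x | v⁻¹ * x ∈ Subgroup.closure α}

/-- `G` together with the generator set `E` is a Cayley group: every element of `E`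
is a non-trivial involution and `E` generates `G`. -/
def IsCayley (E : Set G) : Prop :=
  (∀ e ∈ E, e ≠ 1 ∧ e * e = 1) ∧ Subgroup.closure E = ⊤

/-- A coset cycle of length `m` in the Cayley group `G` with generator set `E`. -/
def IsCosetCycle (E : Set G) (m : ℕ) (v : ZMod m → G) (α : ZMod m → Set G) : Prop :=
  (∀ i, α i ⊆ E) ∧
  (∀ i, (v i)⁻¹ * v (i + 1) ∈ Subgroup.closure (α i)) ∧
  (∀ i, coset (v i) (α (i - 1) ∩ α i) ∩ coset (v (i + 1)) (α i ∩ α (i + 1)) = ∅)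

/-- Coset `n`-acyclic: no coset cycle of length `≤ n`. -/
def CosetAcyclic (E : Set G) (n : ℕ) : Prop :=
  ∀ m, 1 ≤ m → m ≤ n → ∀ (v : ZMod m → G) (α : ZMod m → Set G), ¬ IsCosetCycle E m v α

/-- 2-acyclic: no coset cycle of length 2. -/
def TwoAcyclic (E : Set G) : Prop :=
  ∀ (v : ZMod 2 → G) (α : ZMod 2 → Set G), ¬ IsCosetCycle E 2 v α

/-- Labels of a path of length `ℓ`, where labels with indices outside `1..ℓ` equal `∅`. -/
def extLabel (ℓ : ℕ) (α : ℕ → Set G) (i : ℕ) : Set G :=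
  if 1 ≤ i ∧ i ≤ ℓ then α i else ∅

/-- A coset path of length `ℓ ≥ 1` with vertices `v 1, …, v (ℓ+1)` and labels
`α 1, …, α ℓ` (vertices pairwise distinct except possibly `v 1 = v (ℓ+1)`;
convention `α 0 = α (ℓ+1) = ∅`). -/
def IsCosetPath (E : Set G) (ℓ : ℕ) (v : ℕ → G) (α : ℕ → Set G) : Prop :=
  1 ≤ ℓ ∧
  (∀ i, 1 ≤ i → i ≤ ℓ → α i ⊆ E) ∧
  (∀ i j, 1 ≤ i → i < j → j ≤ ℓ + 1 → v i = v j → i = 1 ∧ j = ℓ + 1) ∧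
  (∀ i, 1 ≤ i → i ≤ ℓ → (v i)⁻¹ * v (i + 1) ∈ Subgroup.closure (α i)) ∧
  (∀ i, 1 ≤ i → i ≤ ℓ →
    coset (v i) (extLabel ℓ α (i - 1) ∩ α i) ∩
      coset (v (i + 1)) (α i ∩ extLabel ℓ α (i + 1)) = ∅)

/-- `γ` is the unique minimal generator set connecting `v` and `u`:
for every `β ⊆ E`, `u ∈ [v]_β` iff `γ ⊆ β`. -/
def IsGen (E : Set G) (v u : G) (γ : Set G) : Prop :=
  γ ⊆ E ∧ ∀ β ⊆ E, (u ∈ coset v β ↔ γ ⊆ β)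

/-- The dual hyperedge `⟦v⟧`: all label-tagged cosets `(α, [v]_α)` for `α ⊆ E`. -/
def dedge (E : Set G) (v : G) : Set (Set G × Set G) :=
  {p | p.1 ⊆ E ∧ p.2 = coset v p.1}

/-- The vertex set of the dual hypergraph: all label-tagged cosets. -/
def dualV (E : Set G) : Set (Set G × Set G) :=
  {p | p.1 ⊆ E ∧ ∃ v : G, p.2 = coset v p.1}

/-- Gaifman adjacency in the dual hypergraph: two distinct vertices lying in a
common hyperedge. -/
def dAdj (E : Set G) (x y : Set G × Set G) : Prop :=
  x ≠ y ∧ ∃ w : G, x ∈ dedge E w ∧ y ∈ dedge E w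

/-- `ρ(v,γ) = { (β, [v]_β) : γ ⊆ β ⊆ E }`. -/
def rho (E : Set G) (v : G) (γ : Set G) : Set (Set G × Set G) :=
  {p | γ ⊆ p.1 ∧ p.1 ⊆ E ∧ p.2 = coset v p.1}

/-- A non-`t` coset path for `t = ρ(w,γ)`: a coset path all of whose links `[v_i]_{α_i}`
fail to contain `[w]_γ`. -/
def IsNonTPath (E : Set G) (w : G) (γ : Set G) (ℓ : ℕ) (v : ℕ → G) (α : ℕ → Set G) : Prop :=
  IsCosetPath E ℓ v α ∧ ∀ i, 1 ≤ i → i ≤ ℓ → ¬ coset w γ ⊆ coset (v i) (α i)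

/-- An inner coset path with respect to `g = gen(v 1, v (ℓ+1))`. -/
def IsInnerPath (E : Set G) (g : Set G) (ℓ : ℕ) (v : ℕ → G) (α : ℕ → Set G) : Prop :=
  IsCosetPath E ℓ v α ∧ 2 ≤ ℓ ∧
    ∀ i, 1 ≤ i → i ≤ ℓ → coset (v i) (α i) ⊂ coset (v 1) g

/-- A non-trivial coset path with respect to `g = gen(v 1, v (ℓ+1))`. -/
def IsNontrivialPath (E : Set G) (g : Set G) (ℓ : ℕ) (v : ℕ → G) (α : ℕ → Set G) : Prop :=
  IsCosetPath E ℓ v α ∧ 2 ≤ ℓ ∧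
    ∀ i, 1 ≤ i → i ≤ ℓ → ¬ coset (v 1) g ⊆ coset (v i) (α i)

/-- `n`-conformality of the dual hypergraph: every Gaifman clique of size `≤ n`
is contained in a hyperedge. -/
def NConformal (E : Set G) (n : ℕ) : Prop :=
  ∀ K : Finset (Set G × Set G), K.card ≤ n → (↑K : Set (Set G × Set G)) ⊆ dualV E →
    (∀ x ∈ K, ∀ y ∈ K, x ≠ y → dAdj E x y) → ∃ w : G, ∀ x ∈ K, x ∈ dedge E w

/-- `n`-chordality of the dual hypergraph: every Gaifman cycle of length `> 3`
and `≤ n` has a chord. -/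
def NChordal (E : Set G) (n : ℕ) : Prop :=
  ∀ m, 4 ≤ m → m ≤ n → ∀ c : ZMod m → Set G × Set G, Function.Injective c →
    (∀ i, c i ∈ dualV E) → (∀ i, dAdj E (c i) (c (i + 1))) →
    ∃ i j : ZMod m, i ≠ j ∧ j ≠ i + 1 ∧ i ≠ j + 1 ∧ dAdj E (c i) (c j)

/-- A walk of length `k` in the Gaifman graph of the dual hypergraph restricted to
the complement of `t = ρ(v,γ)`, from a vertex of `⟦v⟧ \ t` to a vertex of `⟦u⟧ \ t`. -/
def HWalk (E : Set G) (v : G) (γ : Set G) (u : G) (k : ℕ) (c : ℕ → Set G × Set G) : Prop :=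
  c 0 ∈ dedge E v ∧ c k ∈ dedge E u ∧
  (∀ i ≤ k, c i ∈ dualV E ∧ c i ∉ rho E v γ) ∧
  ∀ i < k, dAdj E (c i) (c (i + 1))

/-- The sequence of dual-hypergraph vertices induced by a coset path:
`(∅,[v 1]_∅), (α 1, [v 2]_{α 1}), …, (α ℓ, [v (ℓ+1)]_{α ℓ}), (∅, [v (ℓ+1)]_∅)`. -/
def pathVert (ℓ : ℕ) (v : ℕ → G) (α : ℕ → Set G) (i : ℕ) : Set G × Set G :=
  if i = 0 then (∅, coset (v 1) ∅)
  else if i ≤ ℓ then (α i, coset (v (i + 1)) (α i))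
  else (∅, coset (v (ℓ + 1)) ∅)

end CayleyDefs


section CosetLemmas

variable {G : Type*} [Group G]

theorem mem_coset {v x : G} {α : Set G} : x ∈ coset v α ↔ v⁻¹ * x ∈ Subgroup.closure α :=
  Iff.rfl

theorem mem_coset_comm {v x : G} {α : Set G} : x ∈ coset v α ↔ v ∈ coset x α := by
  rw [mem_coset, mem_coset, ← inv_mem_iff, mul_inv_rev, inv_inv]

theorem coset_mono (v : G) {α β : Set G} (h : α ⊆ β) : coset v α ⊆ coset v β :=
  fun _ hx => Subgroup.closure_mono h hx

theorem coset_inter_coset_eq_empty_iff {v x : G} {α : Set G} :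
    coset v α ∩ coset x α = ∅ ↔ x ∉ coset v α := by
  rw [Set.eq_empty_iff_forall_notMem]
  constructor
  · intro h hx
    exact h x ⟨hx, by simp [mem_coset]⟩
  · rintro h y ⟨hv, hx⟩
    apply h
    have := mul_mem (mem_coset.1 hv) (mem_coset.1 (mem_coset_comm.1 hx))
    rwa [mul_assoc, mul_inv_cancel_left] at this

theorem isCosetCycle_two_iff {E : Set G} {v : ZMod 2 → G} {α : ZMod 2 → Set G} :
    IsCosetCycle E 2 v α ↔ (α 0 ⊆ E ∧ α 1 ⊆ E) ∧ v 1 ∈ coset (v 0) (α 0) ∩ coset (v 0) (α 1) ∧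
      v 1 ∉ coset (v 0) (α 0 ∩ α 1) := by
  have forall_iff (p : ZMod 2 → Prop) : (∀ i, p i) ↔ p 0 ∧ p 1 := Fin.forall_fin_two
  have one_add_one : (1 + 1 : ZMod 2) = 0 := rfl
  have zero_sub_one : (0 - 1 : ZMod 2) = 1 := rfl
  simp only [IsCosetCycle, forall_iff, one_add_one, zero_sub_one, zero_add, sub_self,
    Set.inter_comm (α 1) (α 0), ← mem_coset, coset_inter_coset_eq_empty_iff,
    mem_coset_comm (v := v 1), and_self, Set.mem_inter_iff]

end CosetLemmas

/-- A Cayley group `G` with generator set `E` is 2-acyclic if and only if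
for all `v ∈ G` and all `α, β ⊆ E` one has `[v]_α ∩ [v]_β = [v]_{α ∩ β}`. -/
theorem twoAcyclic_iff_coset_inter {G : Type*} [Group G] (E : Set G) (hC : IsCayley E) :
    TwoAcyclic E ↔
      ∀ (v : G) (α β : Set G), α ⊆ E → β ⊆ E →
        coset v α ∩ coset v β = coset v (α ∩ β) := by
  constructor
  · intro h v α β hα hβ
    refine subset_antisymm (fun x hx => ?_) (Set.subset_inter
      (coset_mono v Set.inter_subset_left) (coset_mono v Set.inter_subset_right))
    by_contra hne
    exact h (![v, x] : Fin 2 → G) (![α, β] : Fin 2 → Set G)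
      (isCosetCycle_two_iff.2 ⟨⟨hα, hβ⟩, hx, hne⟩)
  · intro h v α hcycle
    obtain ⟨⟨h₀, h₁⟩, hmem, hne⟩ := isCosetCycle_two_iff.1 hcycle
    exact hne (h (v 0) (α 0) (α 1) h₀ h₁ ▸ hmem)
end

section
/- Let G be a 2-acyclic Cayley group with generator set E, let v, v_1, …, v_k ∈ G and α_1, …, α_k ⊆ E, and set β := ⋂_{1≤i≤k} α_i. If v ∈ ⋂_{1≤i≤k} [v_i]_{α_i}, then ⋂_{1≤i≤k} [v_i]_{α_i} = [v]_β. -/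
open scoped Pointwise

theorem mem_closure_inter_of_twoAcyclic {G : Type*} [Group G] {E : Set G}
    (h2 : TwoAcyclic E) {α β : Set G} (hα : α ⊆ E) (hβ : β ⊆ E) {g : G}
    (hgα : g ∈ Subgroup.closure α) (hgβ : g ∈ Subgroup.closure β) :
    g ∈ Subgroup.closure (α ∩ β) := by
  by_contra hg
  have key : ∀ x : G, x ∈ Subgroup.closure (α ∩ β) →
      g⁻¹ * x ∉ Subgroup.closure (α ∩ β) := fun x hx hgx => by
    refine hg ?_
    have := mul_mem hx (inv_mem hgx)
    rwa [mul_inv_rev, inv_inv, mul_inv_cancel_left] at this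
  refine h2 ![1, g] ![α, β] ⟨Fin.forall_fin_two.2 ⟨hα, hβ⟩,
    Fin.forall_fin_two.2 ⟨?_, ?_⟩, Fin.forall_fin_two.2 ⟨?_, ?_⟩⟩
  · change (1 : G)⁻¹ * g ∈ Subgroup.closure α
    simpa using hgα
  · change g⁻¹ * 1 ∈ Subgroup.closure β
    simpa using hgβ
  · change coset 1 (β ∩ α) ∩ coset g (α ∩ β) = ∅
    refine Set.eq_empty_of_forall_notMem fun x ⟨hx, hgx⟩ => key x ?_ hgx
    simpa [coset, Set.inter_comm β α] using hx
  · change coset g (α ∩ β) ∩ coset 1 (β ∩ α) = ∅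
    refine Set.eq_empty_of_forall_notMem fun x ⟨hgx, hx⟩ => key x ?_ hgx
    simpa [coset, Set.inter_comm β α] using hx

theorem mem_closure_biInter_of_twoAcyclic {G ι : Type*} [Group G] {E : Set G}
    (h2 : TwoAcyclic E) {α : ι → Set G} (hα : ∀ i, α i ⊆ E) {g : G}
    (hg : ∀ i, g ∈ Subgroup.closure (α i)) {s : Finset ι} (hs : s.Nonempty) :
    g ∈ Subgroup.closure (⋂ i ∈ s, α i) := by
  classical
  induction hs using Finset.Nonempty.cons_induction with
  | singleton a => simpa using hg a
  | cons a s ha hs ih =>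
    have hsub : (⋂ i ∈ s, α i) ⊆ E := by
      obtain ⟨b, hb⟩ := hs
      exact (Set.biInter_subset_of_mem hb).trans (hα b)
    have := mem_closure_inter_of_twoAcyclic h2 (hα a) hsub (hg a) ih
    rwa [Finset.cons_eq_insert, Finset.set_biInter_insert]

/-- in a 2-acyclic Cayley group, if `v ∈ ⋂ i, [v_i]_{α_i}`, then
`⋂ i, [v_i]_{α_i} = [v]_β` for `β = ⋂ i, α_i`. -/
theorem inter_cosets_eq_coset_of_mem {G : Type*} [Group G] (E : Set G) (hC : IsCayley E)
    (h2 : TwoAcyclic E) (k : ℕ) (hk : 1 ≤ k) (vs : Fin k → G) (αs : Fin k → Set G)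
    (hα : ∀ i, αs i ⊆ E) (v : G) (hv : v ∈ ⋂ i, coset (vs i) (αs i)) :
    (⋂ i, coset (vs i) (αs i)) = coset v (⋂ i, αs i) := by
  have : Nonempty (Fin k) := ⟨⟨0, hk⟩⟩
  rw [Set.mem_iInter] at hv
  ext x
  rw [Set.mem_iInter]
  have hx : ∀ i, x ∈ coset (vs i) (αs i) ↔ v⁻¹ * x ∈ Subgroup.closure (αs i) := fun i => by
    have hi : (vs i)⁻¹ * v ∈ Subgroup.closure (αs i) := hv i
    rw [← Subgroup.mul_mem_cancel_left _ hi]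
    simp [coset, mul_assoc]
  simp only [hx]
  constructor
  · intro h
    simpa [coset] using
      mem_closure_biInter_of_twoAcyclic h2 hα h (Finset.univ_nonempty (α := Fin k))
  · exact fun h i => Subgroup.closure_mono (Set.iInter_subset αs i) h
end

section
/- Let G be a 2-acyclic Cayley group with generator set E, let v, u ∈ G, and let e ∈ E with e ∉ gen(v,u). Then gen(v, u·e) = gen(v,u) ∪ {e}. -/
open scoped Pointwise

/-- In a 2-acyclic Cayley group, subgroups generated by sets of generators intersect in the
subgroup generated by the common generators. -/
theorem TwoAcyclic.mem_closure_inter {G : Type*} [Group G] {E : Set G} (h2 : TwoAcyclic E)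
    {α β : Set G} (hα : α ⊆ E) (hβ : β ⊆ E) {x : G}
    (hxα : x ∈ Subgroup.closure α) (hxβ : x ∈ Subgroup.closure β) :
    x ∈ Subgroup.closure (α ∩ β) := by
  by_contra hx
  have disjoint : coset 1 (α ∩ β) ∩ coset x (α ∩ β) = ∅ := by
    refine Set.eq_empty_of_forall_notMem fun y hy => hx ?_
    have h1 : (1 : G)⁻¹ * y ∈ Subgroup.closure (α ∩ β) := hy.1
    have hxy : x⁻¹ * y ∈ Subgroup.closure (α ∩ β) := hy.2
    simpa using mul_mem h1 (inv_mem hxy)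
  refine h2 ![1, x] ![α, β] ⟨?_, ?_, ?_⟩
  · exact Fin.forall_fin_two.2 ⟨hα, hβ⟩
  · refine Fin.forall_fin_two.2 ⟨?_, ?_⟩
    · change (1 : G)⁻¹ * x ∈ Subgroup.closure α
      simpa using hxα
    · change x⁻¹ * 1 ∈ Subgroup.closure β
      simpa using hxβ
  · refine Fin.forall_fin_two.2 ⟨?_, ?_⟩
    · change coset 1 (β ∩ α) ∩ coset x (α ∩ β) = ∅
      rwa [Set.inter_comm β α]
    · change coset x (α ∩ β) ∩ coset 1 (β ∩ α) = ∅
      rwa [Set.inter_comm β α, Set.inter_comm]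

/-- In a 2-acyclic Cayley group, a generator lies in the subgroup generated by a set of
generators only if it belongs to that set. -/
theorem TwoAcyclic.mem_of_mem_closure {G : Type*} [Group G] {E : Set G} (h2 : TwoAcyclic E)
    (hC : IsCayley E) {α : Set G} (hα : α ⊆ E) {e : G} (he : e ∈ E)
    (h : e ∈ Subgroup.closure α) : e ∈ α := by
  by_contra hne
  have hmem := h2.mem_closure_inter hα (Set.singleton_subset_iff.2 he) h
    (Subgroup.mem_closure_singleton_self e)
  rw [Set.inter_singleton_eq_empty.2 hne, Subgroup.closure_empty, Subgroup.mem_bot] at hmem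
  exact (hC.1 e he).1 hmem

/-- in a 2-acyclic Cayley group, for `e ∈ E` with `e ∉ gen(v,u)`,
`gen(v, u·e) = gen(v,u) ∪ {e}`. -/
theorem gen_mul_generator {G : Type*} [Group G] (E : Set G) (hC : IsCayley E)
    (h2 : TwoAcyclic E) (v u : G) (g : Set G) (hg : IsGen E v u g)
    (e : G) (he : e ∈ E) (hne : e ∉ g) :
    IsGen E v (u * e) (g ∪ {e}) := by
  obtain ⟨hgE, hgen⟩ := hg
  have hgeE : g ∪ {e} ⊆ E := Set.union_subset hgE (Set.singleton_subset_iff.2 he)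
  have mul_mem_iff : ∀ β : Set G, e ∈ β → (u * e ∈ coset v β ↔ u ∈ coset v β) := by
    intro β heβ
    change v⁻¹ * (u * e) ∈ Subgroup.closure β ↔ v⁻¹ * u ∈ Subgroup.closure β
    rw [← mul_assoc]
    exact Subgroup.mul_mem_cancel_right _ (Subgroup.subset_closure heβ)
  have he_union : e ∈ g ∪ {e} := Or.inr rfl
  refine ⟨hgeE, fun β hβ => ⟨fun h => ?_, fun h => ?_⟩⟩
  · by_cases heβ : e ∈ β
    · exact Set.union_subset ((hgen β hβ).1 ((mul_mem_iff β heβ).1 h))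
        (Set.singleton_subset_iff.2 heβ)
    · have hunion : u * e ∈ coset v (g ∪ {e}) :=
        (mul_mem_iff _ he_union).2 ((hgen _ hgeE).2 Set.subset_union_left)
      have hsub : (g ∪ {e}) ∩ β ⊆ g := by
        rintro x ⟨hx | rfl, hxβ⟩
        · exact hx
        · exact absurd hxβ heβ
      have hue : v⁻¹ * (u * e) ∈ Subgroup.closure g :=
        Subgroup.closure_mono hsub (h2.mem_closure_inter hgeE hβ hunion h)
      have hu : v⁻¹ * u ∈ Subgroup.closure g := (hgen g hgE).2 subset_rfl
      rw [← mul_assoc, Subgroup.mul_mem_cancel_left _ hu] at hue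
      exact absurd (h2.mem_of_mem_closure hC hgE he hue) hne
  · exact (mul_mem_iff β (h he_union)).2
      ((hgen β hβ).2 (Set.subset_union_left.trans h))
end

section
/- Let G be a 2-acyclic Cayley group with generator set E and let ((v_i, α_i))_{i ∈ ℤ_m} be a finite sequence with v_i ∈ G, α_i ⊆ E, and [v_i]_{α_i} = [v_{i+1}]_{α_i} for all i ∈ ℤ_m (indices mod m). Then for all i ∈ ℤ_m: [v_i]_{α_{i−1} ∩ α_i} ∩ [v_{i+1}]_{α_i ∩ α_{i+1}} = [v_{i−1}]_{α_{i−1}} ∩ [v_i]_{α_i} ∩ [v_{i+1}]_{α_{i+1}}. -/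
open scoped Pointwise

/-- In a 2-acyclic Cayley group, subgroups generated by sets of generators intersect in the
subgroup generated by the common generators. -/
theorem TwoAcyclic.closure_inter {G : Type*} [Group G] {E : Set G} (h2 : TwoAcyclic E)
    {α β : Set G} (hα : α ⊆ E) (hβ : β ⊆ E) :
    Subgroup.closure (α ∩ β) = Subgroup.closure α ⊓ Subgroup.closure β := by
  refine le_antisymm (le_inf (Subgroup.closure_mono Set.inter_subset_left)
    (Subgroup.closure_mono Set.inter_subset_right)) fun g ⟨hgα, hgβ⟩ => ?_
  by_contra hg
  have key : coset 1 (α ∩ β) ∩ coset g (α ∩ β) = ∅ := by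
    refine Set.eq_empty_iff_forall_notMem.2 fun x ⟨h₁, h₂⟩ => hg ?_
    simpa using mul_mem (show 1⁻¹ * x ∈ Subgroup.closure (α ∩ β) from h₁)
      (inv_mem (show g⁻¹ * x ∈ Subgroup.closure (α ∩ β) from h₂))
  have e01 : (0 : ZMod 2) - 1 = 1 := rfl
  have e11 : (1 : ZMod 2) + 1 = 0 := rfl
  have two (i : ZMod 2) : i = 0 ∨ i = 1 := by revert i; decide
  refine h2 (fun i => if i = 0 then 1 else g) (fun i => if i = 0 then α else β) ⟨?_, ?_, ?_⟩ <;>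
    intro i <;> rcases two i with rfl | rfl
  · simpa using hα
  · simpa using hβ
  · simpa using hgα
  · simpa [e11] using hgβ
  · simpa [e01, Set.inter_comm β α] using key
  · simpa [e11, Set.inter_comm β α, Set.inter_comm (coset g _)] using key

theorem TwoAcyclic.coset_inter {G : Type*} [Group G] {E : Set G} (h2 : TwoAcyclic E)
    {α β : Set G} (hα : α ⊆ E) (hβ : β ⊆ E) (v : G) :
    coset v (α ∩ β) = coset v α ∩ coset v β := by
  ext x
  simp [coset, h2.closure_inter hα hβ, Subgroup.mem_inf]

/-- in a 2-acyclic Cayley group, for a cyclic sequence `((v_i, α_i))_{i ∈ ℤ_m}`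
with `[v_i]_{α_i} = [v_{i+1}]_{α_i}` for all `i`, one has, for all `i ∈ ℤ_m`,
`[v_i]_{α_{i-1} ∩ α_i} ∩ [v_{i+1}]_{α_i ∩ α_{i+1}} = [v_{i-1}]_{α_{i-1}} ∩ [v_i]_{α_i} ∩ [v_{i+1}]_{α_{i+1}}`. -/
theorem cosetCut {G : Type*} [Group G] (E : Set G) (hC : IsCayley E) (h2 : TwoAcyclic E)
    (m : ℕ) (hm : 1 ≤ m) (v : ZMod m → G) (α : ZMod m → Set G) (hα : ∀ i, α i ⊆ E)
    (h : ∀ i, coset (v i) (α i) = coset (v (i + 1)) (α i)) (i : ZMod m) :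
    coset (v i) (α (i - 1) ∩ α i) ∩ coset (v (i + 1)) (α i ∩ α (i + 1)) =
      coset (v (i - 1)) (α (i - 1)) ∩ coset (v i) (α i) ∩ coset (v (i + 1)) (α (i + 1)) := by
  have hprev : coset (v (i - 1)) (α (i - 1)) = coset (v i) (α (i - 1)) := by
    simpa using h (i - 1)
  rw [h2.coset_inter (hα _) (hα _), h2.coset_inter (hα _) (hα _), ← h i, hprev,
    ← Set.inter_assoc, Set.inter_assoc (coset (v i) (α (i - 1))), Set.inter_self]
end

section
/- Let n ≥ 3. If G is a coset n-acyclic Cayley group with generator set E, then its dual hypergraph d(G) is n-acyclic, i.e. n-conformal and n-chordal. -/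
open scoped Pointwise

section Helpers

variable {G : Type*} [Group G] {E : Set G}

theorem coset_eq_iff {v w : G} {α : Set G} :
    coset v α = coset w α ↔ v⁻¹ * w ∈ Subgroup.closure α := by
  constructor
  · intro h
    have hw : w ∈ coset w α := by simp [coset, one_mem]
    rwa [← h] at hw
  · intro h
    ext x
    constructor
    · intro hx
      have := mul_mem (inv_mem h) hx
      simpa [coset, mul_assoc] using this
    · intro hx
      have := mul_mem h hx
      simpa [coset, mul_assoc] using this

theorem mem_dedge_of_mem_coset {p : Set G × Set G} {v x : G} {α : Set G}
    (hp : p ∈ dedge E v) (hα : α ⊆ p.1) (hx : x ∈ coset v α) : p ∈ dedge E x :=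
  ⟨hp.1, hp.2.trans (coset_eq_iff.2 (Subgroup.closure_mono hα hx))⟩

/-- In a short cycle of successively adjacent dual vertices, some three consecutive
vertices lie in a common hyperedge. -/
theorem CosetAcyclic.exists_consecutive {n : ℕ} (hacyc : CosetAcyclic E n) {m : ℕ}
    (hm : 1 ≤ m) (hmn : m ≤ n) (c : ZMod m → Set G × Set G) (w : ZMod m → G)
    (hw : ∀ i, c i ∈ dedge E (w i) ∧ c (i + 1) ∈ dedge E (w i)) :
    ∃ i x, c (i - 1) ∈ dedge E x ∧ c i ∈ dedge E x ∧ c (i + 1) ∈ dedge E x := by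
  have hw' : ∀ i, c (i - 1) ∈ dedge E (w (i - 1)) ∧ c i ∈ dedge E (w (i - 1)) := fun i => by
    simpa using hw (i - 1)
  by_contra hcon
  refine hacyc m hm hmn (fun i => w (i - 1)) (fun i => (c i).1)
    ⟨fun i => (hw i).1.1, fun i => ?_, fun i => ?_⟩
  · beta_reduce
    rw [add_sub_cancel_right, ← coset_eq_iff, ← (hw' i).2.2, ← (hw i).1.2]
  · rw [Set.eq_empty_iff_forall_notMem]
    rintro x ⟨h₁, h₂⟩
    beta_reduce at h₁ h₂
    rw [add_sub_cancel_right] at h₂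
    exact hcon ⟨i, x, mem_dedge_of_mem_coset (hw' i).1 Set.inter_subset_left h₁,
      mem_dedge_of_mem_coset (hw' i).2 Set.inter_subset_right h₁,
      mem_dedge_of_mem_coset (hw i).2 Set.inter_subset_right h₂⟩

theorem CosetAcyclic.exists_common_of_three {n : ℕ} (hacyc : CosetAcyclic E n) (hn : 3 ≤ n)
    {p q r : Set G × Set G} (hpq : ∃ w, p ∈ dedge E w ∧ q ∈ dedge E w)
    (hqr : ∃ w, q ∈ dedge E w ∧ r ∈ dedge E w) (hrp : ∃ w, r ∈ dedge E w ∧ p ∈ dedge E w) :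
    ∃ w, p ∈ dedge E w ∧ q ∈ dedge E w ∧ r ∈ dedge E w := by
  obtain ⟨a, ha⟩ := hpq
  obtain ⟨b, hb⟩ := hqr
  obtain ⟨d, hd⟩ := hrp
  obtain ⟨i, x, h₁, h₂, h₃⟩ := hacyc.exists_consecutive (m := 3) (by norm_num) hn
    (![p, q, r] : Fin 3 → _) (![a, b, d] : Fin 3 → G) (by
      intro i
      change Fin 3 at i
      fin_cases i
      exacts [ha, hb, hd])
  refine ⟨x, ?_⟩
  change Fin 3 at i
  fin_cases i
  exacts [⟨h₂, h₃, h₁⟩, ⟨h₁, h₂, h₃⟩, ⟨h₃, h₁, h₂⟩]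

theorem CosetAcyclic.mem_closure_inter {n : ℕ} (hacyc : CosetAcyclic E n) (hn : 2 ≤ n)
    {α β : Set G} (hα : α ⊆ E) (hβ : β ⊆ E) {g : G} (hgα : g ∈ Subgroup.closure α)
    (hgβ : g ∈ Subgroup.closure β) : g ∈ Subgroup.closure (α ∩ β) := by
  have key : ∀ x, x ∈ coset 1 (α ∩ β) → x ∈ coset g (α ∩ β) →
      g ∈ Subgroup.closure (α ∩ β) := by
    intro x h₁ h₂
    simpa using (Subgroup.closure (α ∩ β)).mul_mem h₁ ((Subgroup.closure (α ∩ β)).inv_mem h₂)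
  by_contra hcon
  refine hacyc 2 (by norm_num) hn (![1, g] : Fin 2 → G) (![α, β] : Fin 2 → Set G)
    ⟨fun i => ?_, fun i => ?_, fun i => ?_⟩
  · change Fin 2 at i
    fin_cases i
    exacts [hα, hβ]
  · change Fin 2 at i
    fin_cases i
    · change (1 : G)⁻¹ * g ∈ Subgroup.closure α
      simpa using hgα
    · change g⁻¹ * 1 ∈ Subgroup.closure β
      simpa using hgβ
  · rw [Set.eq_empty_iff_forall_notMem]
    rintro x ⟨h₁, h₂⟩
    change Fin 2 at i
    fin_cases i
    · change x ∈ coset 1 (β ∩ α) at h₁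
      rw [Set.inter_comm] at h₁
      exact hcon (key x h₁ h₂)
    · change x ∈ coset 1 (β ∩ α) at h₂
      rw [Set.inter_comm] at h₂
      exact hcon (key x h₂ h₁)

/-- Helly property: a coset meeting every member of a finite pairwise intersecting family
has a common point with the whole family. -/
theorem CosetAcyclic.exists_common {n : ℕ} (hacyc : CosetAcyclic E n) (hn : 3 ≤ n)
    (K : Finset (Set G × Set G))
    (hK : ∀ x ∈ K, ∀ y ∈ K, x ≠ y → ∃ w, x ∈ dedge E w ∧ y ∈ dedge E w) :
    ∀ p ∈ dualV E, (∀ x ∈ K, ∃ w, p ∈ dedge E w ∧ x ∈ dedge E w) →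
      ∃ w, p ∈ dedge E w ∧ ∀ x ∈ K, x ∈ dedge E w := by
  classical
  induction K using Finset.induction_on with
  | empty =>
    rintro p ⟨hp, v, hv⟩ -
    exact ⟨v, ⟨hp, hv⟩, by simp⟩
  | insert a K ha ih =>
    intro p _ hpK
    obtain ⟨w, hpw, haw⟩ := hpK a (Finset.mem_insert_self a K)
    obtain ⟨x, hx, hxK⟩ := ih
      (fun x hx y hy => hK x (Finset.mem_insert_of_mem hx) y (Finset.mem_insert_of_mem hy))
      (p.1 ∩ a.1, coset w (p.1 ∩ a.1)) ⟨Set.inter_subset_left.trans hpw.1, w, rfl⟩ (by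
        intro b hb
        obtain ⟨z, hpz, hbp⟩ := hpK b (Finset.mem_insert_of_mem hb)
        obtain ⟨x, hpx, hax, hbx⟩ := hacyc.exists_common_of_three hn ⟨w, hpw, haw⟩
          (hK a (Finset.mem_insert_self a K) b (Finset.mem_insert_of_mem hb)
            (fun h => ha (h ▸ hb))) ⟨z, hbp, hpz⟩
        exact ⟨x, ⟨Set.inter_subset_left.trans hpw.1, coset_eq_iff.2
          (hacyc.mem_closure_inter (by omega) hpw.1 haw.1
            (coset_eq_iff.1 (hpw.2.symm.trans hpx.2))
            (coset_eq_iff.1 (haw.2.symm.trans hax.2)))⟩, hbx⟩)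
    have hwx : x ∈ coset w (p.1 ∩ a.1) := coset_eq_iff.1 hx.2
    refine ⟨x, mem_dedge_of_mem_coset hpw Set.inter_subset_left hwx, ?_⟩
    intro y hy
    rcases Finset.mem_insert.1 hy with rfl | hy
    · exact mem_dedge_of_mem_coset haw Set.inter_subset_right hwx
    · exact hxK y hy

end Helpers

/-- for `n ≥ 3`, if `G` is a coset `n`-acyclic Cayley group with generator
set `E`, then its dual hypergraph is `n`-acyclic, i.e. `n`-conformal and `n`-chordal. -/
theorem dual_nAcyclic_of_cosetAcyclic {G : Type*} [Group G] (n : ℕ) (hn : 3 ≤ n)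
    (E : Set G) (hC : IsCayley E) (hacyc : CosetAcyclic E n) :
    NConformal E n ∧ NChordal E n := by
  constructor
  · intro K _ hKV hK
    obtain ⟨w, -, hw⟩ := hacyc.exists_common hn K (fun x hx y hy hxy => (hK x hx y hy hxy).2)
      (E, coset 1 E) ⟨subset_rfl, 1, rfl⟩ (fun x hx => by
        obtain ⟨hxE, v, hv⟩ := hKV hx
        refine ⟨v, ⟨subset_rfl, coset_eq_iff.2 ?_⟩, hxE, hv⟩
        rw [hC.2]
        trivial)
    exact ⟨w, hw⟩
  · intro m hm hmn c hc _ hadj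
    choose w hw using fun i => (hadj i).2
    obtain ⟨i, x, h₁, -, h₃⟩ := hacyc.exists_consecutive (by omega) hmn c w hw
    have hne : ∀ k : ℕ, 0 < k → k < m → (k : ZMod m) ≠ 0 := fun k hk hkm h =>
      absurd (Nat.le_of_dvd hk ((ZMod.natCast_eq_zero_iff k m).1 h)) (by omega)
    have h_one := hne 1 (by omega) (by omega)
    have h_two := hne 2 (by omega) (by omega)
    have h_three := hne 3 (by omega) (by omega)
    push_cast at h_one h_two h_three
    have hi : i - 1 ≠ i + 1 := fun h => h_two (by linear_combination -h)
    exact ⟨i - 1, i + 1, hi, fun h => h_one (by linear_combination h),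
      fun h => h_three (by linear_combination -h), fun h => hi (hc h), x, h₁, h₃⟩
end

section
/- Let G be a 2-acyclic Cayley group with generator set E and let n ≥ 3. If the dual hypergraph d(G) is an n-acyclic hypergraph, then G is coset n-acyclic. -/
open scoped Pointwise

section CosetLemmas

variable {G : Type*} [Group G]

theorem mem_coset_self (v : G) (α : Set G) : v ∈ coset v α := by
  simp [coset, one_mem]

theorem coset_eq_of_mem {v x : G} {α : Set G} (h : x ∈ coset v α) : coset x α = coset v α := by
  have h' : v⁻¹ * x ∈ Subgroup.closure α := h
  ext y
  change x⁻¹ * y ∈ Subgroup.closure α ↔ v⁻¹ * y ∈ Subgroup.closure α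
  rw [← Subgroup.mul_mem_cancel_left _ h']
  simp [mul_assoc]

theorem TwoAcyclic.mem_coset_inter {E : Set G} (h2 : TwoAcyclic E) {α β : Set G} (hα : α ⊆ E)
    (hβ : β ⊆ E) {v x : G} (hxα : x ∈ coset v α) (hxβ : x ∈ coset v β) :
    x ∈ coset v (α ∩ β) := by
  by_contra hx
  refine h2 ![v, x] ![α, β] ⟨?_, ?_, ?_⟩
  · intro i
    fin_cases i
    · exact hα
    · exact hβ
  · intro i
    fin_cases i
    · exact hxα
    · exact mem_coset_comm.1 hxβ
  · have key : coset v (α ∩ β) ∩ coset x (α ∩ β) = ∅ := by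
      refine Set.eq_empty_of_forall_notMem fun y hy => hx ?_
      rw [← coset_eq_of_mem hy.1, coset_eq_of_mem hy.2]
      exact mem_coset_self x _
    intro i
    fin_cases i
    · change coset v (β ∩ α) ∩ coset x (α ∩ β) = ∅
      rwa [Set.inter_comm β α]
    · change coset x (α ∩ β) ∩ coset v (β ∩ α) = ∅
      rwa [Set.inter_comm β α, Set.inter_comm]

namespace IsCosetCycle

variable {E : Set G} {m : ℕ} {v : ZMod m → G} {α : ZMod m → Set G}

theorem shift (h : IsCosetCycle E m v α) (s : ZMod m) :
    IsCosetCycle E m (fun i => v (i + s)) (fun i => α (i + s)) := by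
  obtain ⟨h1, h2, h3⟩ := h
  refine ⟨fun i => h1 _, fun i => ?_, fun i => ?_⟩
  · simpa only [add_right_comm] using h2 (i + s)
  · simpa only [add_right_comm, add_sub_right_comm] using h3 (i + s)

theorem succ_mem (h : IsCosetCycle E m v α) (i : ZMod m) : v (i + 1) ∈ coset (v i) (α i) :=
  h.2.1 i

theorem coset_succ (h : IsCosetCycle E m v α) (i : ZMod m) :
    coset (v (i + 1)) (α i) = coset (v i) (α i) :=
  coset_eq_of_mem (h.succ_mem i)

theorem label_ne_succ (h : IsCosetCycle E m v α) (i : ZMod m) : α i ≠ α (i + 1) := by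
  intro he
  have h3 := h.2.2 i
  rw [← he, Set.inter_self, h.coset_succ] at h3
  exact (h3 ▸ ⟨mem_coset_self _ _, mem_coset_self _ _⟩ : v i ∈ (∅ : Set G))

/-- Three consecutive links of a coset cycle have no common element. -/
theorem notMem_three (h : IsCosetCycle E m v α) (h2 : TwoAcyclic E) (i : ZMod m) {x : G}
    (hx₀ : x ∈ coset (v (i - 1)) (α (i - 1))) (hx₁ : x ∈ coset (v i) (α i))
    (hx₂ : x ∈ coset (v (i + 1)) (α (i + 1))) : False := by
  have h3 := h.2.2 i
  refine (h3 ▸ ⟨?_, ?_⟩ : x ∈ (∅ : Set G))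
  · refine h2.mem_coset_inter (h.1 _) (h.1 _) ?_ hx₁
    have := h.coset_succ (i - 1)
    rw [sub_add_cancel] at this
    rwa [this]
  · refine h2.mem_coset_inter (h.1 _) (h.1 _) ?_ hx₂
    rwa [h.coset_succ]

theorem dAdj_succ (h : IsCosetCycle E m v α) (i : ZMod m) :
    dAdj E (α i, coset (v i) (α i)) (α (i + 1), coset (v (i + 1)) (α (i + 1))) :=
  ⟨fun he => h.label_ne_succ i (congrArg Prod.fst he), v (i + 1),
    ⟨h.1 _, (h.coset_succ i).symm⟩, ⟨h.1 _, rfl⟩⟩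

/-- The first `d` links of a coset cycle, closed up at a common element `w` of the links number
`0` and `d`, form a coset cycle, unless the conditions at `w` fail. -/
theorem shortcut (h : IsCosetCycle E m v α) {d : ℕ} (hd : 2 ≤ d) {w : G}
    (hw₀ : w ∈ coset (v 0) (α 0)) (hwd : w ∈ coset (v d) (α d))
    (h₀ : coset w (α d ∩ α 0) ∩ coset (v 1) (α 0 ∩ α 1) = ∅)
    (h_d : coset (v d) (α (d - 1) ∩ α d) ∩ coset w (α d ∩ α 0) = ∅) :
    IsCosetCycle E (d + 1) (fun k => if k.val = 0 then w else v k.val) (fun k => α k.val) := by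
  have v1 : ((1 : ZMod (d + 1))).val = 1 := ZMod.val_one'' (by omega)
  have split : ∀ k : ZMod (d + 1), k = 0 ∨ k = d ∨
      ∃ j : ℕ, 0 < j ∧ j < d ∧ k = j := by
    intro k
    have := ZMod.val_lt k
    by_cases hk0 : k.val = 0
    · exact Or.inl ((ZMod.val_eq_zero k).1 hk0)
    · by_cases hkd : k.val = d
      · exact Or.inr (Or.inl ((ZMod.natCast_zmod_val k).symm.trans (congrArg _ hkd)))
      · exact Or.inr (Or.inr ⟨k.val, by omega, by omega, by rw [ZMod.natCast_zmod_val]⟩)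
  have val_nat : ∀ j : ℕ, j ≤ d → ((j : ZMod (d + 1))).val = j := fun j hj =>
    ZMod.val_natCast_of_lt (by omega)
  have last : (d : ZMod (d + 1)) + 1 = 0 := by
    exact_mod_cast ZMod.natCast_self (d + 1)
  have neg : (0 : ZMod (d + 1)) - 1 = d := by rw [← last, add_sub_cancel_right]
  have succ : ∀ j : ℕ, (j : ZMod (d + 1)) + 1 = (j + 1 : ℕ) := by intro j; push_cast; rfl
  have pred : ∀ j : ℕ, 0 < j → (j : ZMod (d + 1)) - 1 = (j - 1 : ℕ) := by
    intro j hj; rw [Nat.cast_sub hj, Nat.cast_one]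
  have pred' : ∀ j : ℕ, 0 < j → ((j - 1 : ℕ) : ZMod m) = (j : ZMod m) - 1 := by
    intro j hj; rw [Nat.cast_sub hj, Nat.cast_one]
  refine ⟨fun k => h.1 _, fun k => ?_, fun k => ?_⟩
  · rcases split k with rfl | rfl | ⟨j, hj0, hjd, rfl⟩
    · have := h.succ_mem 0
      rw [zero_add] at this
      have : v 1 ∈ coset w (α 0) := by rwa [coset_eq_of_mem hw₀]
      simp only [zero_add, v1, ZMod.val_zero, if_true, one_ne_zero, if_false, Nat.cast_zero,
        Nat.cast_one]
      exact this
    · simp only [last, val_nat d le_rfl, ZMod.val_zero, if_true, if_neg (show ¬ d = 0 by omega)]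
      exact hwd
    · have := h.succ_mem (j : ZMod m)
      simp only [succ, val_nat j hjd.le, val_nat (j + 1) hjd, if_neg (show ¬ j = 0 by omega),
        if_neg (show ¬ j + 1 = 0 by omega)]
      rw [Nat.cast_add, Nat.cast_one]
      exact this
  · rcases split k with rfl | rfl | ⟨j, hj0, hjd, rfl⟩
    · simp only [neg, zero_add, v1, val_nat d le_rfl, ZMod.val_zero, if_true, one_ne_zero,
        if_false, Nat.cast_zero, Nat.cast_one]
      exact h₀
    · simp only [last, pred d (by omega), val_nat d le_rfl, val_nat (d - 1) (by omega),
        ZMod.val_zero, if_true, if_neg (show ¬ d = 0 by omega), Nat.cast_zero,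
        pred' d (by omega)]
      exact h_d
    · simp only [succ, pred j hj0, val_nat j hjd.le, val_nat (j + 1) hjd,
        val_nat (j - 1) (by omega), if_neg (show ¬ j = 0 by omega),
        if_neg (show ¬ j + 1 = 0 by omega), pred' j hj0]
      rw [Nat.cast_add, Nat.cast_one]
      exact h.2.2 j

/-- In a coset cycle of minimal length, links at distance at least two are disjoint. -/
theorem links_disjoint (h2 : TwoAcyclic E)
    (hmin : ∀ k, 1 ≤ k → k < m → ∀ (v : ZMod k → G) (α : ZMod k → Set G), ¬ IsCosetCycle E k v α)
    {d : ℕ} (hd : 2 ≤ d) (hdm : d + 2 ≤ m) (h : IsCosetCycle E m v α) {w : G}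
    (hw₀ : w ∈ coset (v 0) (α 0)) (hwd : w ∈ coset (v d) (α d)) : False := by
  induction d, hd using Nat.le_induction generalizing v α w with
  | base =>
    have key : ∀ x, x ∈ coset (v 0) (α 0) → x ∈ coset (v 1) (α 1) →
        x ∈ coset (v 2) (α 2) → False := by
      intro x hx₀ hx₁ hx₂
      have h11 : (1 : ZMod m) + 1 = 2 := by norm_num
      refine h.notMem_three h2 1 (x := x) ?_ hx₁ ?_
      · rwa [sub_self]
      · rwa [h11]
    refine hmin 3 (by omega) (by omega) _ _ (h.shortcut le_rfl hw₀ hwd ?_ ?_) <;>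
      refine Set.eq_empty_of_forall_notMem fun x hx => ?_
    · refine key x ?_ (coset_mono _ Set.inter_subset_right hx.2) ?_
      · rw [← coset_eq_of_mem hw₀]
        exact coset_mono _ Set.inter_subset_right hx.1
      · have := coset_mono _ Set.inter_subset_left hx.1
        rw [coset_eq_of_mem hwd] at this
        exact_mod_cast this
    · have h21 : ((2 : ℕ) : ZMod m) - 1 = 1 := by norm_num
      refine key x ?_ ?_ (by exact_mod_cast coset_mono _ Set.inter_subset_right hx.1)
      · rw [← coset_eq_of_mem hw₀]
        exact coset_mono _ Set.inter_subset_right hx.2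
      · have := coset_mono _ Set.inter_subset_left hx.1
        rw [h21] at this
        have hc := h.coset_succ 1
        rw [one_add_one_eq_two] at hc
        rw [← hc]
        exact_mod_cast this
  | succ d hd ih =>
    refine hmin (d + 1 + 1) (by omega) (by omega) _ _
      (h.shortcut (by omega) hw₀ hwd ?_ ?_) <;>
      refine Set.eq_empty_of_forall_notMem fun x hx => ?_
    · refine ih (w := x) (by omega) (h.shift 1) ?_ ?_
      · simpa only [zero_add] using coset_mono _ Set.inter_subset_right hx.2
      · have := coset_mono _ Set.inter_subset_left hx.1
        rw [coset_eq_of_mem hwd] at this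
        exact_mod_cast this
    · refine ih (w := x) (by omega) h ?_ ?_
      · rw [← coset_eq_of_mem hw₀]
        exact coset_mono _ Set.inter_subset_right hx.2
      · have := coset_mono _ Set.inter_subset_left hx.1
        rw [Nat.cast_add, Nat.cast_one, add_sub_cancel_right, h.coset_succ] at this
        exact this

theorem links_disjoint_of_ne [NeZero m] (h2 : TwoAcyclic E)
    (hmin : ∀ k, 1 ≤ k → k < m → ∀ (v : ZMod k → G) (α : ZMod k → Set G), ¬ IsCosetCycle E k v α)
    (h : IsCosetCycle E m v α) {i j : ZMod m} (hij : i ≠ j) (hji1 : j ≠ i + 1)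
    (hij1 : i ≠ j + 1) {w : G} (hwi : w ∈ coset (v i) (α i)) (hwj : w ∈ coset (v j) (α j)) :
    False := by
  have hcast : (((j - i).val : ℕ) : ZMod m) = j - i := ZMod.natCast_zmod_val _
  have hlt := ZMod.val_lt (j - i)
  have h0 : (j - i).val ≠ 0 := fun he => hij (by
    rw [he, Nat.cast_zero] at hcast
    exact (sub_eq_zero.1 hcast.symm).symm)
  have h1 : (j - i).val ≠ 1 := fun he => hji1 (by
    rw [he, Nat.cast_one] at hcast
    rw [hcast]; ring)
  have hm : (j - i).val + 1 ≠ m := fun he => hij1 (by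
    have := ZMod.natCast_self m
    rw [← he, Nat.cast_add, Nat.cast_one] at this
    rw [he, hcast] at this
    linear_combination -this)
  refine links_disjoint h2 hmin (d := (j - i).val) (by omega) (by omega) (h.shift i) (w := w) ?_ ?_
  · simpa only [zero_add] using hwi
  · simpa only [hcast, sub_add_cancel] using hwj

end IsCosetCycle

end CosetLemmas

/-- for `n ≥ 3`, if `G` is a 2-acyclic Cayley group whose dual hypergraph
is `n`-acyclic (`n`-conformal and `n`-chordal), then `G` is coset `n`-acyclic. -/
theorem cosetAcyclic_of_dual_nAcyclic {G : Type*} [Group G] (E : Set G) (hC : IsCayley E)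
    (h2 : TwoAcyclic E) (n : ℕ) (hn : 3 ≤ n)
    (hconf : NConformal E n) (hchord : NChordal E n) :
    CosetAcyclic E n := by
  intro m
  induction m using Nat.strong_induction_on with
  | _ m ih =>
  intro hm hmn v α h
  have hmin : ∀ k, 1 ≤ k → k < m → ∀ (v : ZMod k → G) (α : ZMod k → Set G),
      ¬ IsCosetCycle E k v α := fun k hk hkm => ih k hkm hk (by omega)
  have : NeZero m := ⟨by omega⟩
  have hV : ∀ i, (α i, coset (v i) (α i)) ∈ dualV E := fun i => ⟨h.1 i, v i, rfl⟩
  obtain rfl | rfl | rfl | hm4 : m = 1 ∨ m = 2 ∨ m = 3 ∨ 4 ≤ m := by omega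
  · exact h.label_ne_succ 0 (congrArg α (Subsingleton.elim _ _))
  · exact h2 v α h
  · classical
    obtain ⟨w, hw⟩ := hconf (Finset.univ.image fun i => (α i, coset (v i) (α i)))
      (Finset.card_image_le.trans (by simpa using hn))
      (by
        intro x hx
        simp only [Finset.coe_image, Set.mem_image] at hx
        obtain ⟨i, -, rfl⟩ := hx
        exact hV i)
      (by
        intro x hx y hy hxy
        simp only [Finset.mem_image] at hx hy
        obtain ⟨i, -, rfl⟩ := hx
        obtain ⟨j, -, rfl⟩ := hy
        have hcases : ∀ i j : ZMod 3, i = j ∨ j = i + 1 ∨ i = j + 1 := by decide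
        rcases hcases i j with rfl | rfl | rfl
        · exact absurd rfl hxy
        · exact h.dAdj_succ i
        · obtain ⟨-, u, hu, hu'⟩ := h.dAdj_succ j
          exact ⟨hxy, u, hu', hu⟩)
    have hwi : ∀ i, w ∈ coset (v i) (α i) := fun i => by
      have := (hw _ (Finset.mem_image_of_mem _ (Finset.mem_univ i))).2
      dsimp only at this
      rw [this]
      exact mem_coset_self _ _
    exact h.notMem_three h2 0 (hwi _) (hwi _) (hwi _)
  · by_cases hinj : Function.Injective fun i => (α i, coset (v i) (α i))
    · obtain ⟨i, j, hij, hji1, hij1, -, w, hwi, hwj⟩ :=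
        hchord m hm4 hmn _ hinj hV h.dAdj_succ
      have hi : coset (v i) (α i) = coset w (α i) := hwi.2
      have hj : coset (v j) (α j) = coset w (α j) := hwj.2
      exact h.links_disjoint_of_ne h2 hmin hij hji1 hij1 (w := w)
        (hi ▸ mem_coset_self _ _) (hj ▸ mem_coset_self _ _)
    · simp only [Function.Injective, not_forall] at hinj
      obtain ⟨i, j, heq, hij⟩ := hinj
      obtain ⟨hα, hc⟩ := Prod.mk.inj heq
      refine h.links_disjoint_of_ne h2 hmin hij ?_ ?_ (w := v i) (mem_coset_self _ _)
        (hc ▸ mem_coset_self _ _)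
      · rintro rfl
        exact h.label_ne_succ i hα
      · rintro rfl
        exact h.label_ne_succ j hα.symm
end

section
/- Let n ≥ 2, let G be a coset n-acyclic Cayley group with generator set E, and let v ∈ G. Then there is no coset path of length ≤ n in G that starts and ends at v. -/
open scoped Pointwise

section CosetLemmas

variable {G : Type*} [Group G]

theorem mem_coset_symm {v w : G} {α : Set G} (h : w ∈ coset v α) : v ∈ coset w α := by
  simpa [coset] using (Subgroup.closure α).inv_mem h

theorem mem_coset_trans {u v w : G} {α : Set G} (h : v ∈ coset u α) (h' : w ∈ coset v α) :
    w ∈ coset u α := by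
  simpa [coset, mul_assoc] using (Subgroup.closure α).mul_mem h h'

/-- A closed coset path based at `x`, with labels `α a, …, α b` and inner vertices
`v (a + 1), …, v b`, whose vertices need not be distinct. -/
structure IsClosedCosetPath (E : Set G) (v : ℕ → G) (α : ℕ → Set G) (a b : ℕ) (x : G) :
    Prop where
  lt : a < b
  subset : ∀ i, a ≤ i → i ≤ b → α i ⊆ E
  first : v (a + 1) ∈ coset x (α a)
  last : x ∈ coset (v b) (α b)
  link : ∀ i, a < i → i < b → v (i + 1) ∈ coset (v i) (α i)
  disj : ∀ i, a < i → i < b →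
    coset (v i) (α (i - 1) ∩ α i) ∩ coset (v (i + 1)) (α i ∩ α (i + 1)) = ∅
  notMem_first : x ∉ coset (v (a + 1)) (α a ∩ α (a + 1))
  notMem_last : x ∉ coset (v b) (α (b - 1) ∩ α b)

/-- A closed coset path that also satisfies the disjointness conditions around its base point
is a coset cycle. -/
theorem IsClosedCosetPath.isCosetCycle {E : Set G} {v : ℕ → G} {α : ℕ → Set G} {a k : ℕ} {x : G}
    (h : IsClosedCosetPath E v α a (a + k + 1) x)
    (hfirst : coset x (α (a + k + 1) ∩ α a) ∩ coset (v (a + 1)) (α a ∩ α (a + 1)) = ∅)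
    (hlast : coset (v (a + k + 1)) (α (a + k) ∩ α (a + k + 1)) ∩
      coset x (α (a + k + 1) ∩ α a) = ∅) :
    IsCosetCycle E (k + 2) (fun i => if i.val = 0 then x else v (a + i.val))
      (fun i => α (a + i.val)) := by
  have hlt (i : ZMod (k + 2)) : i.val < k + 2 := ZMod.val_lt i
  have : Fact (1 < k + 2) := ⟨by omega⟩
  have hsucc (i : ZMod (k + 2)) (hi : i.val < k + 1) : (i + 1).val = i.val + 1 := by
    rw [ZMod.val_add_of_lt] <;> rw [ZMod.val_one]
    omega
  have htop (i : ZMod (k + 2)) (hi : i.val = k + 1) : i = -1 :=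
    ZMod.val_injective _ (by rw [hi, ZMod.val_neg_one])
  have hpred (i : ZMod (k + 2)) (hi : i.val ≠ 0) : (i - 1).val = i.val - 1 := by
    have hne : (i - 1).val ≠ k + 1 := fun hc => hi (by
      have := htop _ hc
      rw [sub_eq_neg_self] at this
      simp [this])
    have := hsucc (i - 1) (by have := hlt (i - 1); omega)
    rw [sub_add_cancel] at this
    omega
  refine ⟨fun i => h.subset _ (by omega) (by have := hlt i; omega), fun i => ?_, fun i => ?_⟩
  · change _ ∈ coset _ _
    by_cases h0 : i.val = 0
    · have h1 := hsucc i (by omega)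
      simpa [h0, h1] using h.first
    by_cases hk : i.val = k + 1
    · have h1 : i + 1 = 0 := by rw [htop i hk]; ring
      simpa [hk, h1, ← add_assoc] using h.last
    · have h1 := hsucc i (by have := hlt i; omega)
      simpa [h0, h1, ← add_assoc] using h.link (a + i.val) (by omega) (by have := hlt i; omega)
  · by_cases h0 : i.val = 0
    · have h1 := hsucc i (by omega)
      have h2 : (i - 1).val = k + 1 := by
        rw [(ZMod.val_eq_zero i).1 h0, zero_sub, ZMod.val_neg_one]
      simpa [h0, h1, h2, ← add_assoc] using hfirst
    have h2 := hpred i h0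
    by_cases hk : i.val = k + 1
    · have h1 : i + 1 = 0 := by rw [htop i hk]; ring
      simpa [hk, h1, h2, ← add_assoc] using hlast
    · have h1 := hsucc i (by have := hlt i; omega)
      have h3 : a + (i.val - 1) = a + i.val - 1 := by omega
      simpa [h0, h1, h2, h3, ← add_assoc] using
        h.disj (a + i.val) (by omega) (by have := hlt i; omega)

theorem CosetAcyclic.not_isClosedCosetPath {E : Set G} {n : ℕ} (hE : CosetAcyclic E n)
    (v : ℕ → G) (α : ℕ → Set G) (d : ℕ) :
    ∀ a b x, b - a = d → b - a < n → ¬ IsClosedCosetPath E v α a b x := by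
  induction d using Nat.strong_induction_on with
  | _ d ih =>
    rintro a b x rfl hn h
    have hab := h.lt
    -- a counterexample to the cycle conditions at `x` is the base point of a shorter path
    have key (w : G) (hw : w ∈ coset x (α b ∩ α a))
        (hAB : w ∈ coset (v (a + 1)) (α a ∩ α (a + 1)) ∨
          w ∈ coset (v b) (α (b - 1) ∩ α b)) : False := by
      have hwa : w ∈ coset x (α a) := coset_mono x Set.inter_subset_right hw
      have hwb : w ∈ coset x (α b) := coset_mono x Set.inter_subset_left hw
      have hab2 : a + 1 < b := by
        by_contra hc
        obtain rfl : b = a + 1 := by omega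
        rw [Set.inter_comm] at hw
        rw [Nat.add_sub_cancel, or_self] at hAB
        exact h.notMem_first (mem_coset_trans hAB (mem_coset_symm hw))
      have hfirst (hA : w ∈ coset (v (a + 1)) (α a ∩ α (a + 1))) :
          v (a + 1 + 1) ∈ coset w (α (a + 1)) ∧
            w ∉ coset (v (a + 1 + 1)) (α (a + 1) ∩ α (a + 1 + 1)) :=
        ⟨mem_coset_trans (mem_coset_symm (coset_mono _ Set.inter_subset_right hA))
          (h.link (a + 1) (by omega) hab2), fun hc =>
          Set.eq_empty_iff_forall_notMem.1 (h.disj (a + 1) (by omega) hab2) w ⟨hA, hc⟩⟩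
      have hlast (hB : w ∈ coset (v b) (α (b - 1) ∩ α b)) :
          w ∈ coset (v (b - 1)) (α (b - 1)) ∧
            w ∉ coset (v (b - 1)) (α (b - 1 - 1) ∩ α (b - 1)) := by
        have hb : b - 1 + 1 = b := by omega
        have hl := h.link (b - 1) (by omega) (by omega)
        have hd := h.disj (b - 1) (by omega) (by omega)
        rw [hb] at hl hd
        exact ⟨mem_coset_trans hl (coset_mono _ Set.inter_subset_left hB), fun hc =>
          Set.eq_empty_iff_forall_notMem.1 hd w ⟨hc, hB⟩⟩
      by_cases hA : w ∈ coset (v (a + 1)) (α a ∩ α (a + 1))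
      · by_cases hB : w ∈ coset (v b) (α (b - 1) ∩ α b)
        · have hab3 : a + 1 < b - 1 := by
            by_contra hc
            obtain rfl : b = a + 1 + 1 := by omega
            exact (hfirst hA).2 hB
          exact ih _ (by omega) (a + 1) (b - 1) w rfl (by omega)
            ⟨hab3, fun i _ _ => h.subset i (by omega) (by omega), (hfirst hA).1, (hlast hB).1,
              fun i _ _ => h.link i (by omega) (by omega),
              fun i _ _ => h.disj i (by omega) (by omega), (hfirst hA).2, (hlast hB).2⟩
        · exact ih _ (by omega) (a + 1) b w rfl (by omega)
            ⟨hab2, fun i _ _ => h.subset i (by omega) (by omega), (hfirst hA).1,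
              mem_coset_trans h.last hwb,
              fun i _ _ => h.link i (by omega) (by omega),
              fun i _ _ => h.disj i (by omega) (by omega), (hfirst hA).2, hB⟩
      · have hB := hAB.resolve_left hA
        exact ih _ (by omega) a (b - 1) w rfl (by omega)
          ⟨by omega, fun i _ _ => h.subset i (by omega) (by omega),
            mem_coset_trans (mem_coset_symm hwa) h.first, (hlast hB).1,
            fun i _ _ => h.link i (by omega) (by omega),
            fun i _ _ => h.disj i (by omega) (by omega), hA, (hlast hB).2⟩
    obtain ⟨k, rfl⟩ : ∃ k, b = a + k + 1 := ⟨b - a - 1, by omega⟩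
    exact hE (k + 2) (by omega) (by omega) _ _ (h.isCosetCycle
      (Set.eq_empty_iff_forall_notMem.2 fun w hw => key w hw.1 (.inl hw.2))
      (Set.eq_empty_iff_forall_notMem.2 fun w hw => key w hw.2 (.inr hw.1)))

/-- A coset path that returns to its starting point is a closed coset path. -/
theorem IsCosetPath.isClosedCosetPath {E : Set G} {ℓ : ℕ} {v : ℕ → G} {α : ℕ → Set G}
    (h : IsCosetPath E ℓ v α) (hv : v (ℓ + 1) = v 1) : IsClosedCosetPath E v α 1 ℓ (v 1) := by
  obtain ⟨h1, hsub, -, hlink, hdisj⟩ := h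
  have hlt : 1 < ℓ := by
    by_contra hc
    obtain rfl : ℓ = 1 := by omega
    have := hdisj 1 le_rfl le_rfl
    rw [hv] at this
    simp only [extLabel] at this
    norm_num at this
    exact Set.eq_empty_iff_forall_notMem.1 this _ (mem_coset_self _ _)
  refine ⟨hlt, hsub, hlink 1 le_rfl h1, hv ▸ hlink ℓ h1 le_rfl,
    fun i _ _ => hlink i (by omega) (by omega), fun i hi hi' => ?_, fun hc => ?_, fun hc => ?_⟩
  · have := hdisj i (by omega) (by omega)
    rwa [extLabel, extLabel, if_pos (by omega), if_pos (by omega)] at this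
  · have := hdisj 1 le_rfl h1
    rw [extLabel, extLabel, if_neg (by omega), if_pos (by omega)] at this
    exact Set.eq_empty_iff_forall_notMem.1 this _ ⟨mem_coset_self _ _, hc⟩
  · have := hdisj ℓ h1 le_rfl
    rw [extLabel, extLabel, if_pos (by omega), if_neg (by omega), hv] at this
    exact Set.eq_empty_iff_forall_notMem.1 this _ ⟨hc, mem_coset_self _ _⟩

end CosetLemmas

/-- for `n ≥ 2`, in a coset `n`-acyclic Cayley group there is no coset path
of length `≤ n` that starts and ends at the same vertex `v`. -/
theorem no_short_cyclic_cosetPath {G : Type*} [Group G] (n : ℕ) (hn : 2 ≤ n)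
    (E : Set G) (hC : IsCayley E) (hacyc : CosetAcyclic E n) (v : G) :
    ¬ ∃ (ℓ : ℕ) (vs : ℕ → G) (α : ℕ → Set G),
        ℓ ≤ n ∧ IsCosetPath E ℓ vs α ∧ vs 1 = v ∧ vs (ℓ + 1) = v := by
  rintro ⟨ℓ, vs, α, hℓ, hp, h1, h2⟩
  exact hacyc.not_isClosedCosetPath vs α (ℓ - 1) 1 ℓ (vs 1) rfl (by omega)
    (hp.isClosedCosetPath (h2.trans h1.symm))
end

section
/- (Zipper lemma) Let G be a coset 2n-acyclic Cayley group with generator set E, let v, u ∈ G, and let v, α_1, t_2, α_2, t_3, …, t_ℓ, α_ℓ, u and v, β_1, r_2, β_2, r_3, …, r_k, β_k, u be two coset paths from v to u, each of length at most n (with the convention that labels with indices outside the range of a path equal ∅, and t_1 = r_1 = v, t_{ℓ+1} = r_{k+1} = u). Then: (1) [v]_{β_1 ∩ α_1} ∩ [t_2]_{α_1 ∩ α_2} ≠ ∅ or [v]_{α_1 ∩ β_1} ∩ [r_2]_{β_1 ∩ β_2} ≠ ∅; and (2) [u]_{β_k ∩ α_ℓ} ∩ [t_ℓ]_{α_ℓ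 ∩ α_{ℓ−1}} ≠ ∅ or [u]_{α_ℓ ∩ β_k} ∩ [r_k]_{β_k ∩ β_{k−1}} ≠ ∅. -/
open scoped Pointwise

section CosetChains

variable {G : Type*} [Group G]

theorem inv_mul_mem_comm {H : Subgroup G} {a b : G} : a⁻¹ * b ∈ H ↔ b⁻¹ * a ∈ H := by
  rw [← H.inv_mem_iff]
  simp

theorem inv_mul_mem_trans {H : Subgroup G} {a b c : G} (hab : a⁻¹ * b ∈ H) (hbc : b⁻¹ * c ∈ H) :
    a⁻¹ * c ∈ H := by
  simpa [mul_assoc] using H.mul_mem hab hbc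

theorem zmod_val_add_one (d : ℕ) (i : ZMod (d + 1)) :
    (i + 1).val = if i.val = d then 0 else i.val + 1 := by
  have h : ∀ j : Fin (d + 1), (j + 1).val = if j.val = d then 0 else j.val + 1 := by
    intro j
    simp [Fin.val_add_one, Fin.ext_iff]
  exact h i

theorem zmod_val_sub_one (d : ℕ) (i : ZMod (d + 1)) :
    (i - 1).val = if i.val = 0 then d else i.val - 1 := by
  have h := zmod_val_add_one d (i - 1)
  rw [sub_add_cancel] at h
  have h1 := ZMod.val_lt (i - 1)
  split_ifs at h ⊢ <;> omega

/-- In a coset `N`-acyclic group with `N ≥ 2`, `⟨α⟩ ∩ ⟨β⟩ ≤ ⟨α ∩ β⟩`. -/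
theorem CosetAcyclic.mem_closure_inter_s9 {E : Set G} {N : ℕ} (h : CosetAcyclic E N) (hN : 2 ≤ N)
    {α β : Set G} (hα : α ⊆ E) (hβ : β ⊆ E) {a b : G}
    (h1 : a⁻¹ * b ∈ Subgroup.closure α) (h2 : a⁻¹ * b ∈ Subgroup.closure β) :
    a⁻¹ * b ∈ Subgroup.closure (α ∩ β) := by
  by_contra hab
  have key : coset a (α ∩ β) ∩ coset b (α ∩ β) = ∅ := by
    ext w
    simp only [Set.mem_inter_iff, Set.mem_empty_iff_false, iff_false, not_and]
    intro ha hb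
    exact hab (inv_mul_mem_trans ha (inv_mul_mem_comm.1 hb))
  refine h 2 (by norm_num) hN ![a, b] ![α, β] ⟨?_, ?_, ?_⟩
  · intro i
    fin_cases i
    · exact hα
    · exact hβ
  · intro i
    fin_cases i
    · exact h1
    · exact inv_mul_mem_comm.1 h2
  · intro i
    fin_cases i
    · change coset a (β ∩ α) ∩ coset b (α ∩ β) = ∅
      rwa [Set.inter_comm β α]
    · change coset b (α ∩ β) ∩ coset a (β ∩ α) = ∅
      rwa [Set.inter_comm β α, Set.inter_comm (coset b _)]

/-- A coset cycle given by its links `γ a, …, γ (a + d)`, where `x i` joins `γ (i - 1)` to `γ i`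
and `u` joins `γ (a + d)` to `γ a`. -/
theorem isCosetCycle_of_chain {E : Set G} (x : ℕ → G) (γ : ℕ → Set G) (d : ℕ) (hd : 2 ≤ d)
    (a : ℕ) (u : G) (hγ : ∀ i, a ≤ i → i ≤ a + d → γ i ⊆ E)
    (hfirst : u⁻¹ * x (a + 1) ∈ Subgroup.closure (γ a))
    (hmid : ∀ i, a < i → i < a + d → (x i)⁻¹ * x (i + 1) ∈ Subgroup.closure (γ i))
    (hlast : (x (a + d))⁻¹ * u ∈ Subgroup.closure (γ (a + d)))
    (hsep : ∀ i, a < i → i < a + d →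
      coset (x i) (γ (i - 1) ∩ γ i) ∩ coset (x (i + 1)) (γ i ∩ γ (i + 1)) = ∅)
    (hsepfirst : coset u (γ (a + d) ∩ γ a) ∩ coset (x (a + 1)) (γ a ∩ γ (a + 1)) = ∅)
    (hseplast : coset (x (a + d)) (γ (a + d - 1) ∩ γ (a + d)) ∩ coset u (γ (a + d) ∩ γ a) = ∅) :
    IsCosetCycle E (d + 1) (fun i => if i.val = 0 then u else x (a + i.val))
      (fun i => γ (a + i.val)) := by
  have hlt : ∀ i : ZMod (d + 1), i.val < d + 1 := fun i => ZMod.val_lt i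
  refine ⟨fun i => hγ _ (by omega) (by have := hlt i; omega), fun i => ?_, fun i => ?_⟩
  · have hi := hlt i
    simp only [zmod_val_add_one]
    generalize i.val = j at hi
    rcases (by omega : j = 0 ∨ j = d ∨ (0 < j ∧ j < d)) with rfl | rfl | ⟨h0, h1⟩
    · simpa [show 0 ≠ d by omega] using hfirst
    · simpa [show j ≠ 0 by omega] using hlast
    · simpa [h0.ne', h1.ne, add_assoc] using hmid (a + j) (by omega) (by omega)
  · have hi := hlt i
    simp only [zmod_val_add_one, zmod_val_sub_one]
    generalize i.val = j at hi
    rcases (by omega : j = 0 ∨ j = d ∨ (0 < j ∧ j < d)) with rfl | rfl | ⟨h0, h1⟩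
    · simpa [show 0 ≠ d by omega] using hsepfirst
    · simpa [show j ≠ 0 by omega, Nat.add_sub_assoc (show 1 ≤ j by omega)] using hseplast
    · simpa [h0.ne', h1.ne, add_assoc, Nat.add_sub_assoc (show 1 ≤ j by omega)] using
        hsep (a + j) (by omega) (by omega)

/-- A coset `N`-acyclic group has no cyclic chain of links `γ a, …, γ (a + d)`, `3 ≤ d + 1 ≤ N`,
where `x i` joins `γ (i - 1)` to `γ i` and `u` joins `γ (a + d)` to `γ a`, in which every link
except possibly the two at `u` is separated. -/
theorem CosetAcyclic.false_of_chain {E : Set G} {N : ℕ} (h : CosetAcyclic E N)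
    (x : ℕ → G) (γ : ℕ → Set G) (d : ℕ) (hd : 2 ≤ d) (hN : d + 1 ≤ N) (a : ℕ) (u : G)
    (hγ : ∀ i, a ≤ i → i ≤ a + d → γ i ⊆ E)
    (hfirst : u⁻¹ * x (a + 1) ∈ Subgroup.closure (γ a))
    (hmid : ∀ i, a < i → i < a + d → (x i)⁻¹ * x (i + 1) ∈ Subgroup.closure (γ i))
    (hlast : (x (a + d))⁻¹ * u ∈ Subgroup.closure (γ (a + d)))
    (hsep : ∀ i, a < i → i < a + d →
      coset (x i) (γ (i - 1) ∩ γ i) ∩ coset (x (i + 1)) (γ i ∩ γ (i + 1)) = ∅) :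
    False := by
  induction d generalizing a u with
  | zero => omega
  | succ d ih =>
    by_cases h0 : coset u (γ (a + (d + 1)) ∩ γ a) ∩ coset (x (a + 1)) (γ a ∩ γ (a + 1)) = ∅
    · by_cases h2 : coset (x (a + (d + 1))) (γ (a + (d + 1) - 1) ∩ γ (a + (d + 1))) ∩
          coset u (γ (a + (d + 1)) ∩ γ a) = ∅
      · exact h _ (by omega) hN _ _
          (isCosetCycle_of_chain x γ (d + 1) hd a u hγ hfirst hmid hlast hsep h0 h2)
      · obtain ⟨w, hw1, hw2⟩ := Set.nonempty_iff_ne_empty.2 h2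
        have hwa : u⁻¹ * w ∈ Subgroup.closure (γ a) :=
          Subgroup.closure_mono Set.inter_subset_right hw2
        have hwd : (x (a + d + 1))⁻¹ * w ∈ Subgroup.closure (γ (a + d)) :=
          Subgroup.closure_mono Set.inter_subset_left hw1
        have hfirst' : w⁻¹ * x (a + 1) ∈ Subgroup.closure (γ a) :=
          inv_mul_mem_trans (inv_mul_mem_comm.1 hwa) hfirst
        obtain rfl | hd' := (by omega : d = 1 ∨ 2 ≤ d)
        · have hmem : (x (a + 1))⁻¹ * w ∈ Subgroup.closure (γ a ∩ γ (a + 1)) :=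
            h.mem_closure_inter_s9 (by omega) (hγ a (by omega) (by omega))
              (hγ (a + 1) (by omega) (by omega)) (inv_mul_mem_comm.1 hfirst')
              (inv_mul_mem_trans (hmid (a + 1) (by omega) (by omega)) hwd)
          exact (hsep (a + 1) (by omega) (by omega)).le ⟨hmem, hw1⟩
        · exact ih hd' (by omega) a w (fun i h1 h2 => hγ i h1 (by omega)) hfirst'
            (fun i h1 h2 => hmid i h1 (by omega))
            (inv_mul_mem_trans (hmid (a + d) (by omega) (by omega)) hwd)
            (fun i h1 h2 => hsep i h1 (by omega))
    · obtain ⟨w, hw1, hw2⟩ := Set.nonempty_iff_ne_empty.2 h0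
      have hwd : u⁻¹ * w ∈ Subgroup.closure (γ (a + (d + 1))) :=
        Subgroup.closure_mono Set.inter_subset_left hw1
      have hwa : (x (a + 1))⁻¹ * w ∈ Subgroup.closure (γ (a + 1)) :=
        Subgroup.closure_mono Set.inter_subset_right hw2
      have hlast' : (x (a + (d + 1)))⁻¹ * w ∈ Subgroup.closure (γ (a + (d + 1))) :=
        inv_mul_mem_trans hlast hwd
      have hfirst' : w⁻¹ * x (a + 1 + 1) ∈ Subgroup.closure (γ (a + 1)) :=
        inv_mul_mem_trans (inv_mul_mem_comm.1 hwa) (hmid (a + 1) (by omega) (by omega))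
      obtain rfl | hd' := (by omega : d = 1 ∨ 2 ≤ d)
      · have hmem : (x (a + 2))⁻¹ * w ∈ Subgroup.closure (γ (a + 1) ∩ γ (a + 2)) :=
          h.mem_closure_inter_s9 (by omega) (hγ (a + 1) (by omega) (by omega))
            (hγ (a + 2) (by omega) (by omega)) (inv_mul_mem_comm.1 hfirst') hlast'
        exact (hsep (a + 1) (by omega) (by omega)).le ⟨hw2, hmem⟩
      · have he : a + 1 + d = a + (d + 1) := by omega
        refine ih hd' (by omega) (a + 1) w (fun i h1 h2 => hγ i (by omega) (by omega)) hfirst'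
          (fun i h1 h2 => hmid i (by omega) (by omega)) (by rwa [he])
          (fun i h1 h2 => hsep i (by omega) (by omega))

theorem extLabel_of_mem {X : Type*} {ℓ i : ℕ} {α : ℕ → Set X} (h1 : 1 ≤ i) (h2 : i ≤ ℓ) :
    extLabel ℓ α i = α i := if_pos ⟨h1, h2⟩

theorem extLabel_reverse {X : Type*} (ℓ : ℕ) (α : ℕ → Set X) {i : ℕ} (hi : i ≤ ℓ + 1) :
    extLabel ℓ (fun j => α (ℓ + 1 - j)) i = extLabel ℓ α (ℓ + 1 - i) := by
  unfold extLabel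
  split_ifs <;> first | rfl | omega

theorem IsCosetPath.reverse {E : Set G} {ℓ : ℕ} {t : ℕ → G} {α : ℕ → Set G}
    (h : IsCosetPath E ℓ t α) :
    IsCosetPath E ℓ (fun i => t (ℓ + 2 - i)) (fun i => α (ℓ + 1 - i)) := by
  obtain ⟨h1, h2, h3, h4, h5⟩ := h
  refine ⟨h1, fun i hi hi' => h2 _ (by omega) (by omega), fun i j hi hij hj hv => ?_,
    fun i hi hi' => ?_, fun i hi hi' => ?_⟩
  · have := h3 (ℓ + 2 - j) (ℓ + 2 - i) (by omega) (by omega) (by omega) hv.symm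
    omega
  · have := h4 (ℓ + 1 - i) (by omega) (by omega)
    rw [inv_mul_mem_comm, show ℓ + 1 - i + 1 = ℓ + 2 - i by omega] at this
    dsimp only
    rwa [show ℓ + 2 - (i + 1) = ℓ + 1 - i by omega]
  · have := h5 (ℓ + 1 - i) (by omega) (by omega)
    rw [Set.inter_comm, show ℓ + 1 - i + 1 = ℓ + 2 - i by omega] at this
    dsimp only
    rw [extLabel_reverse ℓ α (by omega), extLabel_reverse ℓ α (by omega),
      show ℓ + 1 - (i - 1) = ℓ + 2 - i by omega, show ℓ + 1 - (i + 1) = ℓ + 1 - i - 1 by omega,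
      show ℓ + 2 - (i + 1) = ℓ + 1 - i by omega, Set.inter_comm (extLabel ℓ α (ℓ + 2 - i)),
      Set.inter_comm (α _) (extLabel ℓ α (ℓ + 1 - i - 1))]
    exact this

/-- Two coset paths with common end points overlap at their starting point. -/
theorem CosetAcyclic.zipper_start {E : Set G} {n ℓ k : ℕ} (hacyc : CosetAcyclic E (2 * n))
    (hℓ : ℓ ≤ n) (hk : k ≤ n) {t r : ℕ → G} {α β : ℕ → Set G} (ht : IsCosetPath E ℓ t α)
    (hr : IsCosetPath E k r β) (hstart : r 1 = t 1) (hend : r (k + 1) = t (ℓ + 1)) :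
    coset (t 1) (extLabel k β 1 ∩ extLabel ℓ α 1) ∩
        coset (t 2) (extLabel ℓ α 1 ∩ extLabel ℓ α 2) ≠ ∅ ∨
      coset (t 1) (extLabel ℓ α 1 ∩ extLabel k β 1) ∩
        coset (r 2) (extLabel k β 1 ∩ extLabel k β 2) ≠ ∅ := by
  obtain ⟨a1, a2, -, a4, a5⟩ := ht
  obtain ⟨b1, b2, -, b4, b5⟩ := hr
  by_contra! hcon
  obtain ⟨c1, c2⟩ := hcon
  rw [extLabel_of_mem le_rfl a1, extLabel_of_mem le_rfl b1] at c1 c2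
  obtain ⟨rfl, rfl⟩ | hlen := (by omega : (ℓ = 1 ∧ k = 1) ∨ 3 ≤ ℓ + k)
  · have hmem : (t 1)⁻¹ * t 2 ∈ Subgroup.closure (β 1 ∩ α 1) :=
      hacyc.mem_closure_inter_s9 (by omega) (b2 1 le_rfl le_rfl) (a2 1 le_rfl le_rfl)
        (by simpa [hstart, hend] using b4 1 le_rfl le_rfl) (a4 1 le_rfl le_rfl)
    exact c1.le ⟨hmem, by simp [coset]⟩
  let x : ℕ → G := fun i => if i ≤ ℓ then t (ℓ + 1 - i) else r (i + 1 - ℓ)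
  let γ : ℕ → Set G := fun i => if i < ℓ then α (ℓ - i) else β (i + 1 - ℓ)
  have xt : ∀ i, i ≤ ℓ → x i = t (ℓ + 1 - i) := fun i hi => if_pos hi
  have xr : ∀ i, ℓ ≤ i → x i = r (i + 1 - ℓ) := by
    intro i hi
    obtain rfl | hi := hi.eq_or_lt
    · rw [xt _ le_rfl, Nat.add_sub_cancel_left, hstart]
    · exact if_neg (by omega)
  have γα : ∀ i, i < ℓ → γ i = α (ℓ - i) := fun i hi => if_pos hi
  have γβ : ∀ i, ℓ ≤ i → γ i = β (i + 1 - ℓ) := fun i hi => if_neg (by omega)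
  refine hacyc.false_of_chain x γ (ℓ + k - 1) (by omega) (by omega) 0 (t (ℓ + 1))
    (fun i _ hi => ?_) ?_ (fun i hi hi' => ?_) ?_ (fun i hi hi' => ?_)
  · obtain h | h := lt_or_ge i ℓ
    · rw [γα i h]
      exact a2 _ (by omega) (by omega)
    · rw [γβ i h]
      exact b2 _ (by omega) (by omega)
  · rw [γα 0 (by omega), xt _ (by omega), inv_mul_mem_comm]
    simpa using a4 ℓ a1 le_rfl
  · obtain h | h := lt_or_ge i ℓ
    · rw [γα i h, xt _ h.le, xt _ h, inv_mul_mem_comm, show ℓ + 1 - (i + 1) = ℓ - i by omega,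
        show ℓ + 1 - i = ℓ - i + 1 by omega]
      exact a4 _ (by omega) (by omega)
    · rw [γβ i h, xr _ h, xr _ (by omega), show i + 1 + 1 - ℓ = i + 1 - ℓ + 1 by omega]
      exact b4 _ (by omega) (by omega)
  · rw [γβ _ (by omega), xr _ (by omega), show 0 + (ℓ + k - 1) + 1 - ℓ = k by omega, ← hend]
    exact b4 k b1 le_rfl
  · obtain h | rfl | rfl | h := (by omega : i + 1 < ℓ ∨ i + 1 = ℓ ∨ i = ℓ ∨ ℓ < i)
    · have := a5 (ℓ - i) (by omega) (by omega)
      rw [extLabel_of_mem (by omega) (by omega), extLabel_of_mem (by omega) (by omega),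
        Set.inter_comm, Set.inter_comm (α (ℓ - i)), Set.inter_comm (α (ℓ - i - 1))] at this
      rw [γα i (by omega), γα _ h, γα (i - 1) (by omega), xt i (by omega), xt (i + 1) (by omega),
        show ℓ - (i - 1) = ℓ - i + 1 by omega, show ℓ - (i + 1) = ℓ - i - 1 by omega,
        show ℓ + 1 - i = ℓ - i + 1 by omega, show ℓ + 1 - (i + 1) = ℓ - i by omega]
      exact this
    · rw [extLabel_of_mem (by omega) (by omega), Set.inter_comm, Set.inter_comm (α 1),
        Set.inter_comm (β 1)] at c1
      rw [γα i (by omega), γα (i - 1) (by omega), γβ _ le_rfl, xt i (by omega), xt _ le_rfl,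
        show i + 1 - (i - 1) = 2 by omega, show i + 1 - i = 1 by omega,
        show i + 1 + 1 - i = 2 by omega, show i + 1 + 1 - (i + 1) = 1 by omega]
      exact c1
    · rw [extLabel_of_mem (i := 2) (by omega) (by omega)] at c2
      rw [γα (i - 1) (by omega), γβ i le_rfl, γβ (i + 1) (by omega), xt i le_rfl,
        xr (i + 1) (by omega), show i - (i - 1) = 1 by omega, show i + 1 - i = 1 by omega,
        show i + 1 + 1 - i = 2 by omega]
      exact c2
    · have := b5 (i + 1 - ℓ) (by omega) (by omega)
      rw [extLabel_of_mem (by omega) (by omega), extLabel_of_mem (by omega) (by omega)] at this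
      rw [γβ i (by omega), γβ (i - 1) (by omega), γβ (i + 1) (by omega), xr i (by omega),
        xr (i + 1) (by omega), show i - 1 + 1 - ℓ = i + 1 - ℓ - 1 by omega,
        show i + 1 + 1 - ℓ = i + 1 - ℓ + 1 by omega]
      exact this

end CosetChains

/-- Zipper lemma: in a coset `2n`-acyclic Cayley group, two coset paths
from `v` to `u` of lengths `ℓ, k ≤ n` overlap non-trivially at both ends
(labels with indices outside the range of a path equal `∅`). -/
theorem zipper_lemma {G : Type*} [Group G] (n : ℕ) (E : Set G) (hC : IsCayley E)
    (hacyc : CosetAcyclic E (2 * n)) (v u : G)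
    (ℓ k : ℕ) (hℓ : ℓ ≤ n) (hk : k ≤ n)
    (t : ℕ → G) (α : ℕ → Set G) (hp1 : IsCosetPath E ℓ t α)
    (ht1 : t 1 = v) (ht2 : t (ℓ + 1) = u)
    (r : ℕ → G) (β : ℕ → Set G) (hp2 : IsCosetPath E k r β)
    (hr1 : r 1 = v) (hr2 : r (k + 1) = u) :
    (coset v (extLabel k β 1 ∩ extLabel ℓ α 1) ∩
        coset (t 2) (extLabel ℓ α 1 ∩ extLabel ℓ α 2) ≠ ∅ ∨
      coset v (extLabel ℓ α 1 ∩ extLabel k β 1) ∩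
        coset (r 2) (extLabel k β 1 ∩ extLabel k β 2) ≠ ∅) ∧
    (coset u (extLabel k β k ∩ extLabel ℓ α ℓ) ∩
        coset (t ℓ) (extLabel ℓ α ℓ ∩ extLabel ℓ α (ℓ - 1)) ≠ ∅ ∨
      coset u (extLabel ℓ α ℓ ∩ extLabel k β k) ∩
        coset (r k) (extLabel k β k ∩ extLabel k β (k - 1)) ≠ ∅) := by
  subst ht1 ht2
  have a1 := hp1.1
  have b1 := hp2.1
  refine ⟨hacyc.zipper_start hℓ hk hp1 hp2 hr1 hr2, ?_⟩
  have key := hacyc.zipper_start hℓ hk hp1.reverse hp2.reverse (by simpa using hr2)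
    (by simpa using hr1)
  rw [extLabel_reverse ℓ α (by omega), extLabel_reverse ℓ α (by omega),
    extLabel_reverse k β (by omega), extLabel_reverse k β (by omega)] at key
  exact key
end
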